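/- Let Γ be a Neumaier graph with parameters (n,k,λ;1,c), i.e., with nexus a = 1. Then λ = c − 2 and k − 2c + 3 > 0. -/

import Mathlib

open Finset SimpleGraph Matrix

/-- A finset `C` is a regular clique with nexus `a` in `G`: it is a clique and every
vertex outside `C` has exactly `a` neighbors in `C`. -/
def SimpleGraph.IsRegularCliqueWithNexus {V : Type*} [Fintype V] [DecidableEq V]
    (G : SimpleGraph V) [DecidableRel G.Adj] (C : Finset V) (a : ℕ) : Prop :=
  G.IsClique (C : Set V) ∧ ∀ v ∉ C, (C.filter fun u => G.Adj v u).card = a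

/-- `G` is edge-regular with parameters `(n, k, l)`: it has `n` vertices, is `k`-regular,
and any two adjacent vertices have exactly `l` common neighbors. -/
def SimpleGraph.IsEdgeRegular {V : Type*} [Fintype V] [DecidableEq V]
    (G : SimpleGraph V) [DecidableRel G.Adj] (n k l : ℕ) : Prop :=
  Fintype.card V = n ∧ G.IsRegularOfDegree k ∧
    ∀ u v : V, G.Adj u v → Fintype.card (G.commonNeighbors u v) = l

/-- `G` is a Neumaier graph with parameters `(n, k, l; a, c)`: a connected, non-complete,
edge-regular graph with parameters `(n, k, l)` containing a regular clique of size `c`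
with nexus `a ≥ 1`. -/
def SimpleGraph.IsNeumaier {V : Type*} [Fintype V] [DecidableEq V]
    (G : SimpleGraph V) [DecidableRel G.Adj] (n k l a c : ℕ) : Prop :=
  G.Connected ∧ G ≠ ⊤ ∧ G.IsEdgeRegular n k l ∧ 1 ≤ a ∧
    ∃ C : Finset V, C.card = c ∧ G.IsRegularCliqueWithNexus C a
namespace SimpleGraph

variable {V : Type*} [Fintype V] [DecidableEq V] {G : SimpleGraph V} [DecidableRel G.Adj]
  {C : Finset V}

theorem IsRegularCliqueWithNexus.eq_of_adj (hC : G.IsRegularCliqueWithNexus C 1) {w u v : V}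
    (hw : w ∉ C) (hu : u ∈ C) (hv : v ∈ C) (hwu : G.Adj w u) (hwv : G.Adj w v) : u = v :=
  Finset.card_le_one.mp (hC.2 w hw).le u (by simp [hu, hwu]) v (by simp [hv, hwv])

theorem IsRegularCliqueWithNexus.exists_adj (hC : G.IsRegularCliqueWithNexus C 1) {w : V}
    (hw : w ∉ C) : ∃ u ∈ C, G.Adj w u := by
  have h : 0 < (C.filter fun u => G.Adj w u).card := by rw [hC.2 w hw]; exact one_pos
  obtain ⟨u, hu⟩ := Finset.card_pos.mp h
  exact ⟨u, Finset.mem_filter.mp hu⟩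

/-- The common neighbours of two vertices of a regular clique with nexus one are exactly the
other vertices of the clique. -/
theorem IsRegularCliqueWithNexus.card_commonNeighbors (hC : G.IsRegularCliqueWithNexus C 1)
    {u v : V} (hu : u ∈ C) (hv : v ∈ C) (huv : u ≠ v) :
    Fintype.card (G.commonNeighbors u v) = C.card - 2 := by
  have h : (G.commonNeighbors u v).toFinset = (C.erase u).erase v := by
    ext w
    simp only [Set.mem_toFinset, mem_commonNeighbors, Finset.mem_erase]
    refine ⟨fun ⟨h₁, h₂⟩ => ⟨h₂.ne', h₁.ne', ?_⟩, fun ⟨h₁, h₂, hw⟩ =>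
      ⟨hC.1 hu hw h₂.symm, hC.1 hv hw h₁.symm⟩⟩
    by_contra hw
    exact huv (hC.eq_of_adj hw hu hv h₁.symm h₂.symm)
  rw [← Set.toFinset_card, h, Finset.card_erase_of_mem (by simp [hv, huv.symm]),
    Finset.card_erase_of_mem hu, Nat.sub_sub]

/-- A clique vertex `u` with a neighbour `w` outside the clique is adjacent to the rest of the
clique, to `w`, and to the common neighbours of `u` and `w`, and these are all distinct. -/
theorem IsRegularCliqueWithNexus.card_add_card_commonNeighbors_le_degree
    (hC : G.IsRegularCliqueWithNexus C 1) {u w : V} (hu : u ∈ C) (hw : w ∉ C)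
    (huw : G.Adj u w) :
    C.card + Fintype.card (G.commonNeighbors u w) ≤ G.degree u := by
  have hd : Disjoint (C.erase u) (insert w (G.commonNeighbors u w).toFinset) := by
    rw [Finset.disjoint_left]
    intro x hx hx'
    obtain ⟨hxu, hxC⟩ := Finset.mem_erase.mp hx
    rcases Finset.mem_insert.mp hx' with rfl | hx'
    · exact hw hxC
    · exact hxu (hC.eq_of_adj hw hxC hu (Set.mem_toFinset.mp hx').2 huw.symm)
  have hs : C.erase u ∪ insert w (G.commonNeighbors u w).toFinset ⊆ G.neighborFinset u := by
    intro x hx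
    rw [mem_neighborFinset]
    simp only [Finset.mem_union, Finset.mem_erase, Finset.mem_insert, Set.mem_toFinset,
      mem_commonNeighbors] at hx
    rcases hx with ⟨hxu, hxC⟩ | rfl | ⟨h, -⟩
    exacts [hC.1 hu hxC hxu.symm, huw, h]
  have hle := Finset.card_le_card hs
  rw [Finset.card_union_of_disjoint hd, Finset.card_insert_of_notMem
    (by simp [mem_commonNeighbors]), Set.toFinset_card, card_neighborFinset_eq_degree,
    Finset.card_erase_of_mem hu] at hle
  have := Finset.card_pos.mpr ⟨u, hu⟩
  omega

theorem IsRegularOfDegree.eq_top_of_forall_adj {k : ℕ} (hG : G.IsRegularOfDegree k) {x : V}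
    (hx : ∀ w, w ≠ x → G.Adj w x) : G = ⊤ := by
  have hk : k = Fintype.card V - 1 := by
    rw [← hG x, ← card_neighborFinset_eq_degree, ← Finset.card_univ,
      ← Finset.card_erase_of_mem (Finset.mem_univ x)]
    congr 1
    ext w
    simpa using ⟨fun h => h.ne', fun h => (hx w h).symm⟩
  ext a b
  rw [top_adj]
  refine ⟨Adj.ne, fun hab => ?_⟩
  have hs : G.neighborFinset a ⊆ Finset.univ.erase a := fun w hw => by
    simpa using ((G.mem_neighborFinset a w).mp hw).ne'
  have he := Finset.eq_of_subset_of_card_le hs (by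
    rw [card_neighborFinset_eq_degree, hG a, hk,
      Finset.card_erase_of_mem (Finset.mem_univ a), Finset.card_univ])
  rw [← mem_neighborFinset, he]
  simpa using hab.symm

end SimpleGraph

/-- Lemma 3.9: in a Neumaier graph with parameters (n,k,l;1,c) (nexus a = 1), one has
l = c - 2 and k - 2c + 3 > 0. -/
theorem neumaier_nexus_one {V : Type*} [Fintype V] [DecidableEq V]
    (G : SimpleGraph V) [DecidableRel G.Adj] (n k l c : ℕ)
    (h : G.IsNeumaier n k l 1 c) :
    (l : ℤ) = (c : ℤ) - 2 ∧ (k : ℤ) - 2 * c + 3 > 0 := by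
  obtain ⟨-, hne, ⟨-, hreg, hl⟩, -, C, rfl, hC⟩ := h
  obtain ⟨w, hw⟩ : ∃ w, w ∉ C := by
    by_contra! hall
    refine hne (SimpleGraph.ext ?_)
    ext a b
    exact ⟨Adj.ne, fun hab => hC.1 (hall a) (hall b) hab⟩
  obtain ⟨u, hu, hwu⟩ := hC.exists_adj hw
  obtain ⟨v, hv, hvu⟩ : ∃ v ∈ C, v ≠ u := by
    by_contra! hall
    refine hne (hreg.eq_top_of_forall_adj (x := u) fun y hy => ?_)
    obtain ⟨z, hz, hyz⟩ := hC.exists_adj fun hyC => hy (hall y hyC)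
    exact hall z hz ▸ hyz
  have hc : 1 < C.card := Finset.one_lt_card.mpr ⟨v, hv, u, hu, hvu⟩
  have hcl := hC.card_commonNeighbors hv hu hvu
  rw [hl v u (hC.1 hv hu hvu)] at hcl
  have hdeg := hC.card_add_card_commonNeighbors_le_degree hu hw hwu.symm
  rw [hl u w hwu.symm, hreg u] at hdeg
  omega
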